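/- arXiv:1906.06867 — 2 statements merged into one kernel-verified Lean document; each statement's English description precedes it below -/
import Mathlib

section
/- Let A and B be real-valued random variables on a probability space with A > 0 and B ≥ 0 almost surely, such that A, ln A, B, ln(1+A), and ln(1+B) are all integrable. Then E[ max( ln(1+A) − ln(1+B), 0 ) ] ≥ max( ln(1 + exp(E[ln A])) − ln(1 + E[B]), 0 ). -/
open MeasureTheory

/-- The convex function `x ↦ log (1 + exp x)` lies above its tangent line at `c`. -/
lemma log_one_add_exp_tangent_le (c x : ℝ) :
    Real.log (1 + Real.exp c) + Real.exp c / (1 + Real.exp c) * (x - c) ≤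
      Real.log (1 + Real.exp x) := by
  have hc := Real.exp_pos c
  have hconv := convexOn_exp.2 (Set.mem_univ (0 : ℝ)) (Set.mem_univ (x - c))
    (show 0 ≤ 1 / (1 + Real.exp c) by positivity)
    (show 0 ≤ Real.exp c / (1 + Real.exp c) by positivity) (by field_simp)
  simp only [smul_eq_mul, mul_zero, zero_add, Real.exp_zero, mul_one, Real.exp_sub] at hconv
  rw [Real.le_log_iff_exp_le (by positivity), Real.exp_add, Real.exp_log (by positivity)]
  calc _ ≤ (1 + Real.exp c) * (1 / (1 + Real.exp c) +
        Real.exp c / (1 + Real.exp c) * (Real.exp x / Real.exp c)) := by gcongr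
    _ = 1 + Real.exp x := by field_simp

/-- Jensen's inequality for `x ↦ log (1 + exp x)`. -/
lemma log_one_add_exp_integral_le {Ω : Type*} [MeasurableSpace Ω] {μ : Measure Ω}
    [IsProbabilityMeasure μ] {X : Ω → ℝ} (hX : Integrable X μ)
    (hX' : Integrable (fun ω => Real.log (1 + Real.exp (X ω))) μ) :
    Real.log (1 + Real.exp (∫ ω, X ω ∂μ)) ≤ ∫ ω, Real.log (1 + Real.exp (X ω)) ∂μ := by
  set c := ∫ ω, X ω ∂μ with hc
  have hsub : Integrable (fun ω => X ω - c) μ := hX.sub (integrable_const c)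
  have h := integral_mono ((integrable_const (Real.log (1 + Real.exp c))).add
    (hsub.const_mul (Real.exp c / (1 + Real.exp c)))) hX'
    fun ω => log_one_add_exp_tangent_le c (X ω)
  rwa [integral_add' (integrable_const _) (hsub.const_mul _), integral_const_mul,
    integral_sub hX (integrable_const c), ← hc, integral_const, integral_const, probReal_univ,
    one_smul, one_smul, sub_self, mul_zero, add_zero] at h

/-- Jensen's inequality for `x ↦ log (1 + x)` on nonnegative random variables. -/
lemma integral_log_one_add_le {Ω : Type*} [MeasurableSpace Ω] {μ : Measure Ω}
    [IsProbabilityMeasure μ] {X : Ω → ℝ} (hX₀ : ∀ᵐ ω ∂μ, 0 ≤ X ω) (hX : Integrable X μ)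
    (hX' : Integrable (fun ω => Real.log (1 + X ω)) μ) :
    ∫ ω, Real.log (1 + X ω) ∂μ ≤ Real.log (1 + ∫ ω, X ω ∂μ) := by
  have hm : 0 ≤ ∫ ω, X ω ∂μ := integral_nonneg_of_ae hX₀
  set m := ∫ ω, X ω ∂μ with hm_def
  have hsub : Integrable (fun ω => X ω - m) μ := hX.sub (integrable_const m)
  have h := integral_mono_ae hX' ((integrable_const (Real.log (1 + m))).add
    (hsub.const_mul (1 + m)⁻¹)) <| by
      filter_upwards [hX₀] with ω hω
      have hlog := Real.log_le_sub_one_of_pos (show 0 < (1 + X ω) / (1 + m) by positivity)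
      rw [Real.log_div (by positivity) (by positivity)] at hlog
      have heq : (1 + X ω) / (1 + m) - 1 = (1 + m)⁻¹ * (X ω - m) := by
        field_simp
        ring
      simp only [Pi.add_apply]
      linarith
  rwa [integral_add' (integrable_const _) (hsub.const_mul _), integral_const_mul,
    integral_sub hX (integrable_const m), ← hm_def, integral_const, integral_const,
    probReal_univ, one_smul, one_smul, sub_self, mul_zero, add_zero] at h

/-- Structural content of Theorem 4 of the paper: with `A > 0` and `B ≥ 0`
a.s., and `A`, `ln A`, `B`, `ln(1+A)`, `ln(1+B)` integrable,
`E[(ln(1+A) − ln(1+B))⁺] ≥ (ln(1+exp(E[ln A])) − ln(1+E[B]))⁺`. -/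
theorem stmt_9 {Ω : Type*} [MeasurableSpace Ω] (μ : Measure Ω) [IsProbabilityMeasure μ]
    (A B : Ω → ℝ) (hA : ∀ᵐ ω ∂μ, 0 < A ω) (hB : ∀ᵐ ω ∂μ, 0 ≤ B ω)
    (hAint : Integrable A μ)
    (hlogA : Integrable (fun ω => Real.log (A ω)) μ)
    (hBint : Integrable B μ)
    (hlog1A : Integrable (fun ω => Real.log (1 + A ω)) μ)
    (hlog1B : Integrable (fun ω => Real.log (1 + B ω)) μ) :
    ∫ ω, max (Real.log (1 + A ω) - Real.log (1 + B ω)) 0 ∂μ ≥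
      max (Real.log (1 + Real.exp (∫ ω, Real.log (A ω) ∂μ)) -
        Real.log (1 + ∫ ω, B ω ∂μ)) 0 := by
  have hexp : (fun ω => Real.log (1 + Real.exp (Real.log (A ω)))) =ᵐ[μ]
      fun ω => Real.log (1 + A ω) := by
    filter_upwards [hA] with ω hω
    rw [Real.exp_log hω]
  have h₁ := log_one_add_exp_integral_le hlogA (hlog1A.congr hexp.symm)
  rw [integral_congr_ae hexp] at h₁
  have h₂ := integral_log_one_add_le hB hBint hlog1B
  have hdiff : Integrable (fun ω => Real.log (1 + A ω) - Real.log (1 + B ω)) μ :=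
    hlog1A.sub hlog1B
  have h₃ := integral_mono hdiff hdiff.pos_part fun ω => le_max_left _ 0
  rw [integral_sub hlog1A hlog1B] at h₃
  exact max_le (by linarith) (integral_nonneg fun ω => le_max_right _ _)
end

section
/- Let λ ≥ 0 be a real number. Then ∫_0^∞ (1/2)·ln(x)·e^{−(x+λ)/2}·( Σ_{j=0}^{∞} (λx)^j / (4^j (j!)²) ) dx = e^{−λ/2} · Σ_{k=0}^{∞} ((λ/2)^k / k!) · ( H_k − γ + ln 2 ), where H_k is the k-th harmonic number (H_0 = 0) and γ is the Euler–Mascheroni constant; in particular the integral converges. -/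
open MeasureTheory

/-- A series of integrable functions whose `L¹` norms are summable has an integrable sum. -/
theorem MeasureTheory.integrable_tsum_of_summable_integral_norm {α E : Type*}
    [MeasurableSpace α] {μ : Measure α} [NormedAddCommGroup E] [NormedSpace ℝ E]
    [CompleteSpace E] {F : ℕ → α → E} (hF : ∀ i, Integrable (F i) μ)
    (hsum : Summable fun i => ∫ a, ‖F i a‖ ∂μ) :
    Integrable (fun a => ∑' i, F i a) μ := by
  have hfin : ∫⁻ a, ∑' i, ‖F i a‖ₑ ∂μ ≠ ⊤ := by
    rw [lintegral_tsum fun i => (hF i).1.enorm]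
    simp_rw [← fun i => ofReal_integral_norm_eq_lintegral_enorm (hF i)]
    exact hsum.tsum_ofReal_ne_top
  have hae : ∀ᵐ a ∂μ, Summable fun i => F i a := by
    filter_upwards [ae_lt_top' (AEMeasurable.tsum fun i => (hF i).1.enorm) hfin]
      with a ha
    exact (NNReal.summable_coe.2 (ENNReal.tsum_coe_ne_top_iff_summable.1 ha.ne)).of_norm
  refine ⟨aestronglyMeasurable_of_tendsto_ae Filter.atTop
    (f := fun n a => ∑ i ∈ Finset.range n, F i a)
    (fun n => Finset.aestronglyMeasurable_fun_sum _ fun i _ => (hF i).1) ?_, ?_⟩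
  · filter_upwards [hae] with a ha using ha.hasSum.tendsto_sum_nat
  · exact (lintegral_mono fun a => enorm_tsum_le_tsum_enorm).trans_lt hfin.lt_top

theorem integrableOn_pow_mul_exp_neg (k : ℕ) :
    IntegrableOn (fun x : ℝ => x ^ k * Real.exp (-x)) (Set.Ioi 0) := by
  have h := Real.GammaIntegral_convergent (s := k + 1) (by positivity)
  simpa [mul_comm] using h

theorem integral_pow_mul_exp_neg (k : ℕ) :
    ∫ x in Set.Ioi (0 : ℝ), x ^ k * Real.exp (-x) = (k.factorial : ℝ) := by
  have h := Real.Gamma_eq_integral (s := k + 1) (by positivity)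
  rw [Real.Gamma_nat_eq_factorial] at h
  simpa [mul_comm] using h.symm

theorem integrableOn_log_mul_pow_mul_exp_neg (k : ℕ) :
    IntegrableOn (fun x : ℝ => Real.log x * (x ^ k * Real.exp (-x))) (Set.Ioi 0) := by
  have h := (mellin_hasDerivAt_of_isBigO_rpow (E := ℂ) (f := fun x : ℝ => (Real.exp (-x) : ℂ))
    (a := k + 2) (b := 0) (s := k + 1) ?_ ?_ ?_ ?_ ?_).1
  · refine IntegrableOn.congr_fun (Integrable.re h) (fun x _ => ?_) measurableSet_Ioi
    simp only [add_sub_cancel_right, Complex.cpow_natCast, smul_eq_mul, Complex.real_smul,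
      RCLike.re_eq_complex_re]
    norm_cast
    ring
  · exact (Continuous.continuousOn (by fun_prop)).locallyIntegrableOn measurableSet_Ioi
  · rw [← Asymptotics.isBigO_norm_left]
    simp_rw [Complex.norm_real, Asymptotics.isBigO_norm_left]
    simpa only [neg_one_mul] using (isLittleO_exp_neg_mul_rpow_atTop zero_lt_one _).isBigO
  · norm_num
  · simp_rw [neg_zero, Real.rpow_zero]
    exact Asymptotics.IsBigO.mono (Asymptotics.isBigO_const_of_tendsto
      (Continuous.tendsto (by fun_prop) 0) (by simp) (c := (1 : ℝ))) nhdsWithin_le_nhds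
  · norm_num; positivity

theorem integral_log_mul_pow_mul_exp_neg (k : ℕ) :
    ∫ x in Set.Ioi (0 : ℝ), Real.log x * (x ^ k * Real.exp (-x)) =
      k.factorial * ((∑ i ∈ Finset.range k, (1 : ℝ) / (i + 1)) -
        Real.eulerMascheroniConstant) := by
  have hre : 0 < ((k : ℂ) + 1).re := by norm_num; positivity
  have h1 := Complex.hasDerivAt_GammaIntegral hre
  have h2 : HasDerivAt Complex.GammaIntegral _ _ :=
    (Complex.hasDerivAt_Gamma_nat k).congr_of_eventuallyEq (by
      filter_upwards [(isOpen_lt continuous_const Complex.continuous_re).mem_nhds hre] with s hs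
        using (Complex.Gamma_eq_integral hs).symm)
  have h3 := h1.unique h2
  have h4 : ∫ x in Set.Ioi (0 : ℝ), (x : ℂ) ^ ((k : ℂ) + 1 - 1) *
      ((Real.log x : ℂ) * (Real.exp (-x) : ℂ)) =
      ((∫ x in Set.Ioi (0 : ℝ), Real.log x * (x ^ k * Real.exp (-x)) : ℝ) : ℂ) := by
    rw [← integral_complex_ofReal]
    congr 1 with x
    rw [add_sub_cancel_right, Complex.cpow_natCast]
    push_cast
    ring
  rw [h4] at h3
  have h5 : (∑ i ∈ Finset.range k, (1 : ℝ) / (i + 1)) = (harmonic k : ℝ) := by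
    simp [harmonic]
  rw [h5, sub_eq_neg_add]
  exact_mod_cast h3

theorem integral_abs_log_mul_pow_mul_exp_neg_le (k : ℕ) :
    ∫ x in Set.Ioi (0 : ℝ), |Real.log x * (x ^ k * Real.exp (-x))| ≤
      (∫ x in Set.Ioi (0 : ℝ), |Real.log x * (x ^ 0 * Real.exp (-x))|) +
        (k + 1).factorial := by
  have h0 : IntegrableOn (fun x : ℝ => |Real.log x * (x ^ 0 * Real.exp (-x))|) (Set.Ioi 0) :=
    (integrableOn_log_mul_pow_mul_exp_neg 0).abs
  rw [← integral_pow_mul_exp_neg, ← integral_add h0 (integrableOn_pow_mul_exp_neg _)]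
  refine setIntegral_mono_on (integrableOn_log_mul_pow_mul_exp_neg k).abs
    (h0.add (integrableOn_pow_mul_exp_neg _)) measurableSet_Ioi fun x (hx : 0 < x) => ?_
  have key : |Real.log x| * x ^ k ≤ |Real.log x| + x ^ (k + 1) := by
    rcases le_total x 1 with h | h
    · have := mul_le_mul_of_nonneg_left (pow_le_one₀ hx.le h (n := k)) (abs_nonneg (Real.log x))
      have : 0 < x ^ (k + 1) := by positivity
      linarith
    · rw [abs_of_nonneg (Real.log_nonneg h), pow_succ']
      have := mul_le_mul_of_nonneg_right (Real.log_le_self hx.le) (pow_nonneg hx.le k)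
      linarith [Real.log_nonneg h]
  rw [abs_mul, abs_mul (Real.log x), abs_of_pos (show 0 < x ^ k * Real.exp (-x) by positivity),
    abs_of_pos (show 0 < x ^ 0 * Real.exp (-x) by positivity)]
  have := mul_le_mul_of_nonneg_right key (Real.exp_pos (-x)).le
  linarith

theorem summable_succ_mul_pow_div_factorial (r : ℝ) :
    Summable fun k : ℕ => ((k : ℝ) + 1) * (r ^ k / k.factorial) := by
  have h := Real.summable_pow_div_factorial r
  have h' : Summable fun k : ℕ => (k : ℝ) * (r ^ k / k.factorial) := by
    rw [← summable_nat_add_iff 1]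
    refine (h.mul_left r).congr fun k => ?_
    rw [Nat.factorial_succ]
    push_cast
    field_simp
    ring
  exact (h'.add h).congr fun k => by ring

/-- Exact (untruncated) content of Lemma 1 of the paper for `b = 0`: the mean
of `ln X` for a noncentral chi-square variable `X` with two degrees of freedom
and noncentrality `λ ≥ 0`, with density `(1/2)e^{−(x+λ)/2} I₀(√(λx))`:
`∫_0^∞ (1/2) ln x e^{−(x+λ)/2} (∑_j (λx)ʲ/(4ʲ (j!)²)) dx
  = e^{−λ/2} ∑_k ((λ/2)ᵏ/k!)(H_k − γ + ln 2)`;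
in particular the integrand is integrable on `(0,∞)`. -/
theorem stmt_12 (lam : ℝ) (hlam : 0 ≤ lam) :
    IntegrableOn
      (fun x : ℝ => (1 / 2) * Real.log x * Real.exp (-(x + lam) / 2) *
        ∑' j : ℕ, (lam * x) ^ j / (4 ^ j * ((j.factorial : ℝ)) ^ 2))
      (Set.Ioi (0 : ℝ)) ∧
    ∫ x in Set.Ioi (0 : ℝ),
        (1 / 2) * Real.log x * Real.exp (-(x + lam) / 2) *
          ∑' j : ℕ, (lam * x) ^ j / (4 ^ j * ((j.factorial : ℝ)) ^ 2) =
      Real.exp (-lam / 2) *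
        ∑' k : ℕ, ((lam / 2) ^ k / (k.factorial : ℝ)) *
          ((∑ i ∈ Finset.range k, (1 : ℝ) / (i + 1)) -
            Real.eulerMascheroniConstant + Real.log 2) := by
  set c : ℕ → ℝ := fun k => Real.exp (-lam / 2) / 2 * ((lam / 2) ^ k / (k.factorial : ℝ) ^ 2)
    with hc
  have hc0 : ∀ k, 0 ≤ c k := fun k => by positivity
  set F : ℕ → ℝ → ℝ := fun k t =>
    c k * (Real.log t * (t ^ k * Real.exp (-t)) + Real.log 2 * (t ^ k * Real.exp (-t))) with hF
  set f : ℝ → ℝ := fun x => (1 / 2) * Real.log x * Real.exp (-(x + lam) / 2) *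
    ∑' j : ℕ, (lam * x) ^ j / (4 ^ j * ((j.factorial : ℝ)) ^ 2) with hf
  have hfF : Set.EqOn (fun t => ∑' k, F k t) (fun t => f (2 * t)) (Set.Ioi 0) := by
    intro t (ht : 0 < t)
    simp only [hf, hF, hc]
    rw [← tsum_mul_left]
    refine tsum_congr fun k => ?_
    rw [Real.log_mul two_ne_zero ht.ne', show -(2 * t + lam) / 2 = -lam / 2 + -t by ring,
      Real.exp_add, show lam * (2 * t) = 4 * (lam / 2 * t) by ring, mul_pow 4, mul_pow]
    field_simp
    ring
  have hpow := integrableOn_pow_mul_exp_neg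
  have hlog := integrableOn_log_mul_pow_mul_exp_neg
  have hFint : ∀ k, Integrable (F k) (volume.restrict (Set.Ioi 0)) := fun k =>
    ((hlog k).add ((hpow k).const_mul _)).const_mul _
  have hFval : ∀ k, ∫ t in Set.Ioi (0 : ℝ), F k t = Real.exp (-lam / 2) / 2 *
      ((lam / 2) ^ k / (k.factorial : ℝ) * ((∑ i ∈ Finset.range k, (1 : ℝ) / (i + 1)) -
        Real.eulerMascheroniConstant + Real.log 2)) := fun k => by
    simp only [hF, hc]
    rw [integral_const_mul, integral_add (hlog k) ((hpow k).const_mul _), integral_const_mul,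
      integral_log_mul_pow_mul_exp_neg, integral_pow_mul_exp_neg]
    field_simp
  have hsum : Summable fun k => ∫ t in Set.Ioi (0 : ℝ), ‖F k t‖ := by
    set C := ∫ x in Set.Ioi (0 : ℝ), |Real.log x * (x ^ 0 * Real.exp (-x))|
    have hC : 0 ≤ C := integral_nonneg fun x => abs_nonneg _
    refine Summable.of_nonneg_of_le (fun k => integral_nonneg fun x => norm_nonneg _)
      (fun k => ?_) ((summable_succ_mul_pow_div_factorial (lam / 2)).mul_left
        (Real.exp (-lam / 2) / 2 * (C + 1 + Real.log 2)))
    have hl2 : 0 < Real.log 2 := Real.log_pos one_lt_two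
    calc ∫ t in Set.Ioi (0 : ℝ), ‖F k t‖
        ≤ ∫ t in Set.Ioi (0 : ℝ), c k * (|Real.log t * (t ^ k * Real.exp (-t))| +
            Real.log 2 * (t ^ k * Real.exp (-t))) := by
          refine setIntegral_mono_on (hFint k).norm
            (((hlog k).abs.add ((hpow k).const_mul _)).const_mul _) measurableSet_Ioi
            fun t (ht : 0 < t) => ?_
          rw [Real.norm_eq_abs, abs_mul, abs_of_nonneg (hc0 k)]
          refine mul_le_mul_of_nonneg_left ((abs_add_le _ _).trans_eq ?_) (hc0 k)
          rw [abs_of_nonneg (a := Real.log 2 * _) (by positivity)]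
      _ ≤ c k * ((C + (k + 1).factorial) + Real.log 2 * k.factorial) := by
          rw [integral_const_mul, integral_add (hlog k).abs ((hpow k).const_mul _),
            integral_const_mul, integral_pow_mul_exp_neg]
          exact mul_le_mul_of_nonneg_left
            (add_le_add_left (integral_abs_log_mul_pow_mul_exp_neg_le k) _) (hc0 k)
      _ ≤ c k * ((C + 1 + Real.log 2) * ((k + 1) * k.factorial)) := by
          refine mul_le_mul_of_nonneg_left ?_ (hc0 k)
          have h1 : (1 : ℝ) ≤ k.factorial := by exact_mod_cast k.factorial_pos
          have h2 : (k.factorial : ℝ) ≤ (k + 1) * k.factorial := by nlinarith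
          rw [Nat.factorial_succ]
          push_cast
          nlinarith
      _ = _ := by
          simp only [hc]
          field_simp
  have hint := integrable_tsum_of_summable_integral_norm hFint hsum
  refine ⟨?_, ?_⟩
  · have := (integrableOn_Ioi_comp_mul_left_iff f 0 two_pos).1
      (IntegrableOn.congr_fun hint hfF measurableSet_Ioi)
    rwa [mul_zero] at this
  · have h := integral_comp_mul_left_Ioi' f 0 two_pos
    rw [mul_zero, ← setIntegral_congr_fun measurableSet_Ioi hfF,
      ← integral_tsum_of_summable_integral_norm hFint hsum] at h
    rw [← h]
    simp_rw [hFval]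
    rw [tsum_mul_left, smul_eq_mul]
    ring
end
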